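/- arXiv:2509.21920 — 2 statements merged into one kernel-verified Lean document; each statement's English description precedes it below -/
import Mathlib

section
/- Let T > 0, τ > 0, w ∈ ℝ, μ > 0, and spike times t₁, …, t_K ∈ [0, T]. Define u(T) = (w/τ)·exp(−T/τ)·∫_ℝ exp(s/τ)·Σ_{k=1}^{K} G_{μ,t_k}(s) ds and u_δ(T) = (w/τ)·Σ_{k=1}^{K} exp(−(T − t_k)/τ). Then |u(T) − u_δ(T)| ≤ (K·|w|/τ)·(exp(μ²/(2τ²)) − 1). In particular the Gaussian-regularized output potential converges to the δ-driven one as μ → 0⁺, uniformly in the choice of spike times in [0, T]. -/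
open Real

lemma aux_gauss (τ μ a : ℝ) (hτ : 0 < τ) (hμ : 0 < μ) (s : ℝ) :
    Real.exp (s / τ) * ((1 / (μ * Real.sqrt (2 * π))) *
          Real.exp (-(s - a) ^ 2 / (2 * μ ^ 2))) =
    Real.exp (a / τ + μ ^ 2 / (2 * τ ^ 2)) *
      ProbabilityTheory.gaussianPDFReal (a + μ ^ 2 / τ) (μ ^ 2).toNNReal s := by
  have h1 : Real.sqrt (2 * π * μ ^ 2) = μ * Real.sqrt (2 * π) := by
    rw [Real.sqrt_mul (by positivity), Real.sqrt_sq hμ.le, mul_comm]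
  simp only [ProbabilityTheory.gaussianPDFReal, Real.coe_toNNReal _ (sq_nonneg μ), h1]
  rw [mul_left_comm, mul_left_comm (Real.exp (a / τ + μ ^ 2 / (2 * τ ^ 2))),
    ← Real.exp_add, ← Real.exp_add, one_div]
  congr 2
  field_simp
  ring

/-- Discrepancy between the Gaussian-regularized and δ-driven output LIF
potentials at the final time `T`: for spike times `t₁,…,t_K ∈ [0,T]`,
`|u(T) − u_δ(T)| ≤ (K |w| / τ) (exp (μ²/(2τ²)) − 1)`, a bound uniform in the
choice of spike times, which tends to `0` as `μ → 0⁺`. -/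
theorem output_LIF_gaussian_delta_discrepancy (T τ w μ : ℝ) (hT : 0 < T)
    (hτ : 0 < τ) (hμ : 0 < μ) (K : ℕ) (t : Fin K → ℝ)
    (ht : ∀ k, t k ∈ Set.Icc (0 : ℝ) T)
    (uT uδT : ℝ)
    (huT : uT = (w / τ) * Real.exp (-T / τ) *
      ∫ s : ℝ, Real.exp (s / τ) *
        ∑ k : Fin K, (1 / (μ * Real.sqrt (2 * π))) *
          Real.exp (-(s - t k) ^ 2 / (2 * μ ^ 2)))
    (huδT : uδT = (w / τ) * ∑ k : Fin K, Real.exp (-(T - t k) / τ)) :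
    |uT - uδT| ≤ ((K : ℝ) * |w| / τ) * (Real.exp (μ ^ 2 / (2 * τ ^ 2)) - 1) := by
  have hv : (μ ^ 2).toNNReal ≠ 0 := by
    have : 0 < (μ ^ 2).toNNReal := Real.toNNReal_pos.2 (by positivity)
    exact this.ne'
  have hint : (∫ s : ℝ, Real.exp (s / τ) *
        ∑ k : Fin K, (1 / (μ * Real.sqrt (2 * π))) *
          Real.exp (-(s - t k) ^ 2 / (2 * μ ^ 2))) =
      ∑ k : Fin K, Real.exp (t k / τ + μ ^ 2 / (2 * τ ^ 2)) := by
    simp_rw [Finset.mul_sum, aux_gauss τ μ _ hτ hμ]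
    rw [MeasureTheory.integral_finsetSum]
    · refine Finset.sum_congr rfl fun k _ => ?_
      rw [MeasureTheory.integral_const_mul,
        ProbabilityTheory.integral_gaussianPDFReal_eq_one _ hv, mul_one]
    · intro k _
      exact (ProbabilityTheory.integrable_gaussianPDFReal _ _).const_mul _
  have hE : 0 ≤ Real.exp (μ ^ 2 / (2 * τ ^ 2)) - 1 := by
    have := Real.one_le_exp (show 0 ≤ μ ^ 2 / (2 * τ ^ 2) by positivity)
    linarith
  have hd : uT - uδT = (w / τ) * (∑ k : Fin K, Real.exp (-(T - t k) / τ)) *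
      (Real.exp (μ ^ 2 / (2 * τ ^ 2)) - 1) := by
    have h2 : Real.exp (-T / τ) * ∑ k : Fin K, Real.exp (t k / τ + μ ^ 2 / (2 * τ ^ 2)) =
        (∑ k : Fin K, Real.exp (-(T - t k) / τ)) * Real.exp (μ ^ 2 / (2 * τ ^ 2)) := by
      rw [Finset.mul_sum, Finset.sum_mul]
      refine Finset.sum_congr rfl fun k _ => ?_
      rw [← Real.exp_add, ← Real.exp_add]
      congr 1
      ring
    rw [huT, huδT, hint, mul_assoc, h2]
    ring
  have hS0 : 0 ≤ ∑ k : Fin K, Real.exp (-(T - t k) / τ) :=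
    Finset.sum_nonneg fun k _ => (Real.exp_pos _).le
  have hS : ∑ k : Fin K, Real.exp (-(T - t k) / τ) ≤ K := by
    calc _ ≤ ∑ k : Fin K, (1 : ℝ) := by
          refine Finset.sum_le_sum fun k _ => Real.exp_le_one_iff.2 ?_
          exact div_nonpos_of_nonpos_of_nonneg (by linarith [(ht k).2]) hτ.le
      _ = K := by simp
  rw [hd, abs_mul, abs_mul, abs_of_nonneg hE, abs_of_nonneg hS0, abs_div, abs_of_pos hτ]
  refine mul_le_mul_of_nonneg_right ?_ hE
  calc |w| / τ * _ ≤ |w| / τ * K := mul_le_mul_of_nonneg_left hS (by positivity)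
    _ = _ := by ring
end

section
/- Let T > 0, τ > 0, w ∈ ℝ, μ > 0, θ_u ∈ ℝ, let σ : ℝ → ℝ be L-Lipschitz, let P, K ≥ 1, ν ∈ ℝ^P, and let x, α₁, …, α_P ∈ ℝ^d. Suppose that for each p ∈ {1, …, P} there are spike times t_{p,1}, …, t_{p,K} ∈ [0, T] with (w/τ)·Σ_{k=1}^{K} exp(−(T − t_{p,k})/τ) = θ_u + ⟨α_p, x⟩. Define u_p(T) = (w/τ)·exp(−T/τ)·∫_ℝ exp(s/τ)·Σ_{k=1}^{K} G_{μ,t_{p,k}}(s) ds. Then |Σ_{p=1}^{P} ν_p·σ(u_p(T) − θ_u) − Σ_{p=1}^{P} ν_p·σ(⟨α_p, x⟩)| ≤ L·(Σ_{p=1}^{P} |ν_p|)·(K·|w|/τ)·(exp(μ²/(2τ²)) − 1). In particular, the SNN readout output approximates the shallow neural network Σ_p ν_p σ(⟨α_p, x⟩) with error tending to 0 as μ → 0⁺. -/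
open Real

lemma aux_pt (τ μ a s : ℝ) (hτ : 0 < τ) (hμ : 0 < μ) :
    Real.exp (s / τ) * ((1 / (μ * Real.sqrt (2 * π))) *
          Real.exp (-(s - a) ^ 2 / (2 * μ ^ 2))) =
    Real.exp (a / τ + μ ^ 2 / (2 * τ ^ 2)) *
      ProbabilityTheory.gaussianPDFReal (a + μ ^ 2 / τ) (Real.toNNReal (μ ^ 2)) s := by
  rw [ProbabilityTheory.gaussianPDFReal]
  have h1 : Real.sqrt (2 * π * μ ^ 2) = μ * Real.sqrt (2 * π) := by
    rw [Real.sqrt_mul (by positivity), Real.sqrt_sq hμ.le, mul_comm]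
  rw [Real.coe_toNNReal _ (sq_nonneg μ)]
  rw [h1, one_div, mul_left_comm, mul_left_comm (Real.exp _), ← Real.exp_add, ← Real.exp_add]
  congr 2
  field_simp
  ring

lemma aux_int (τ μ : ℝ) (hτ : 0 < τ) (hμ : 0 < μ) (K : ℕ) (t : Fin K → ℝ) :
    ∫ s : ℝ, Real.exp (s / τ) *
        ∑ k : Fin K, (1 / (μ * Real.sqrt (2 * π))) *
          Real.exp (-(s - t k) ^ 2 / (2 * μ ^ 2)) =
    ∑ k : Fin K, Real.exp (t k / τ + μ ^ 2 / (2 * τ ^ 2)) := by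
  simp_rw [Finset.mul_sum, aux_pt τ μ _ _ hτ hμ]
  rw [MeasureTheory.integral_finsetSum]
  · refine Finset.sum_congr rfl fun k _ => ?_
    rw [MeasureTheory.integral_const_mul, ProbabilityTheory.integral_gaussianPDFReal_eq_one,
      mul_one]
    intro h
    exact absurd (Real.toNNReal_eq_zero.mp h) (not_le.mpr (pow_pos hμ 2))
  · intro k _
    exact (ProbabilityTheory.integrable_gaussianPDFReal _ _).const_mul _

/-- The SNN readout approximates a shallow neural network: if for each `p`
the spike times `t_{p,1},…,t_{p,K} ∈ [0,T]` encode the value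
`θ_u + ⟨α_p, x⟩` through the δ-driven output potential, then the readout of
the Gaussian-regularized output potentials satisfies
`|Σ_p ν_p σ(u_p(T) − θ_u) − Σ_p ν_p σ(⟨α_p, x⟩)|
  ≤ L (Σ_p |ν_p|) (K |w| / τ) (exp (μ²/(2τ²)) − 1)`,
an error tending to `0` as `μ → 0⁺`. -/
theorem SNN_readout_approximates_shallow_network
    (T τ w μ θu L : ℝ) (hT : 0 < T) (hτ : 0 < τ) (hμ : 0 < μ) (hL : 0 ≤ L)
    (σ : ℝ → ℝ) (hσ : ∀ a b : ℝ, |σ a - σ b| ≤ L * |a - b|)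
    (P K d : ℕ) (hP : 1 ≤ P) (hK : 1 ≤ K)
    (ν : Fin P → ℝ) (x : Fin d → ℝ) (α : Fin P → Fin d → ℝ)
    (t : Fin P → Fin K → ℝ) (ht : ∀ p k, t p k ∈ Set.Icc (0 : ℝ) T)
    (hencode : ∀ p : Fin P,
      (w / τ) * ∑ k : Fin K, Real.exp (-(T - t p k) / τ) =
        θu + ∑ j : Fin d, α p j * x j)
    (u : Fin P → ℝ)
    (hu : ∀ p : Fin P, u p = (w / τ) * Real.exp (-T / τ) *
      ∫ s : ℝ, Real.exp (s / τ) *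
        ∑ k : Fin K, (1 / (μ * Real.sqrt (2 * π))) *
          Real.exp (-(s - t p k) ^ 2 / (2 * μ ^ 2))) :
    |(∑ p : Fin P, ν p * σ (u p - θu)) -
        ∑ p : Fin P, ν p * σ (∑ j : Fin d, α p j * x j)| ≤
      L * (∑ p : Fin P, |ν p|) * ((K : ℝ) * |w| / τ) *
        (Real.exp (μ ^ 2 / (2 * τ ^ 2)) - 1) := by
  have hE : 0 ≤ Real.exp (μ ^ 2 / (2 * τ ^ 2)) - 1 := by
    have : 1 ≤ Real.exp (μ ^ 2 / (2 * τ ^ 2)) := Real.one_le_exp (by positivity)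
    linarith
  have key : ∀ p, |u p - θu - ∑ j : Fin d, α p j * x j| ≤
      ((K : ℝ) * |w| / τ) * (Real.exp (μ ^ 2 / (2 * τ ^ 2)) - 1) := by
    intro p
    have e1 : u p - θu - ∑ j : Fin d, α p j * x j =
        (w / τ) * (∑ k : Fin K, Real.exp (-(T - t p k) / τ)) *
          (Real.exp (μ ^ 2 / (2 * τ ^ 2)) - 1) := by
      have : u p = (w / τ) * (∑ k : Fin K, Real.exp (-(T - t p k) / τ)) *
          Real.exp (μ ^ 2 / (2 * τ ^ 2)) := by
        rw [hu, aux_int τ μ hτ hμ, mul_assoc, mul_assoc, Finset.mul_sum, Finset.sum_mul]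
        congr 1
        refine Finset.sum_congr rfl fun k _ => ?_
        rw [← Real.exp_add, ← Real.exp_add]
        congr 1
        ring
      rw [sub_sub, ← hencode p, this]
      ring
    have e2 : ∑ k : Fin K, Real.exp (-(T - t p k) / τ) ≤ K := by
      calc _ ≤ ∑ k : Fin K, (1 : ℝ) := by
            refine Finset.sum_le_sum fun k _ => ?_
            rw [Real.exp_le_one_iff]
            exact div_nonpos_of_nonpos_of_nonneg (by linarith [(ht p k).2]) hτ.le
        _ = K := by simp
    have e3 : 0 ≤ ∑ k : Fin K, Real.exp (-(T - t p k) / τ) :=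
      Finset.sum_nonneg fun k _ => (Real.exp_pos _).le
    rw [e1, abs_mul, abs_mul, abs_of_nonneg hE, abs_of_nonneg e3, abs_div, abs_of_pos hτ]
    refine mul_le_mul_of_nonneg_right ?_ hE
    calc |w| / τ * _ ≤ |w| / τ * K := mul_le_mul_of_nonneg_left e2 (by positivity)
      _ = _ := by ring
  rw [← Finset.sum_sub_distrib]
  refine (Finset.abs_sum_le_sum_abs _ _).trans ?_
  have : L * (∑ p : Fin P, |ν p|) * ((K : ℝ) * |w| / τ) * (Real.exp (μ ^ 2 / (2 * τ ^ 2)) - 1) =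
      ∑ p : Fin P, |ν p| * (L * (((K : ℝ) * |w| / τ) * (Real.exp (μ ^ 2 / (2 * τ ^ 2)) - 1))) := by
    rw [← Finset.sum_mul]
    ring
  rw [this]
  refine Finset.sum_le_sum fun p _ => ?_
  rw [← mul_sub, abs_mul]
  refine mul_le_mul_of_nonneg_left ?_ (abs_nonneg _)
  exact (hσ _ _).trans (mul_le_mul_of_nonneg_left (key p) hL)
end
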